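/- Let E be a nontrivial finite-dimensional real inner product space, K ∈ ℝ, N < 0, and f : E → ℝ continuously differentiable. Let ξ : [0,T) → E be continuous and continuously differentiable on (0,T), and suppose that for every z ∈ E and almost every t ∈ (0,T) (with ‖ξ(t) − z‖ < π√(N/K) when K < 0) the derivative at t of s ↦ 𝔰_{K/N}(‖ξ(s) − z‖/2)², call it D, satisfies D + K·𝔰_{K/N}(‖ξ(t) − z‖/2)² ≤ (N/2)·(1 − f_N(z)/f_N(ξ(t))). Then ξ'(t) = −∇f(ξ(t)) for all t ∈ (0,T). -/

import Mathlib

open Real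
open scoped RealInnerProductSpace

/-- The comparison function `𝔰_κ`. -/
noncomputable def sk (κ θ : ℝ) : ℝ :=
  if 0 < κ then Real.sin (Real.sqrt κ * θ) / Real.sqrt κ
  else if κ = 0 then θ
  else Real.sinh (Real.sqrt (-κ) * θ) / Real.sqrt (-κ)

/-- The comparison function `𝔠_κ`. -/
noncomputable def ck (κ θ : ℝ) : ℝ :=
  if 0 < κ then Real.cos (Real.sqrt κ * θ)
  else if κ = 0 then 1
  else Real.cosh (Real.sqrt (-κ) * θ)

/-- The distortion coefficient `σ_κ^{(t)}(θ)`. -/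
noncomputable def sg (κ t θ : ℝ) : ℝ := if θ = 0 then t else sk κ (t * θ) / sk κ θ

theorem sk_hasDerivAt (κ θ : ℝ) : HasDerivAt (sk κ) (ck κ θ) θ := by
  unfold sk ck
  by_cases h : 0 < κ
  · simp only [h, if_true]
    have hs : Real.sqrt κ ≠ 0 := (Real.sqrt_pos.2 h).ne'
    have := (((hasDerivAt_id θ).const_mul (Real.sqrt κ)).sin).div_const (Real.sqrt κ)
    refine this.congr_deriv ?_
    simp only [id]
    field_simp
  · by_cases h0 : κ = 0
    · subst h0
      simp only [lt_irrefl, if_true, if_false]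
      exact hasDerivAt_id' θ
    · simp only [h, h0, if_false]
      have hs : Real.sqrt (-κ) ≠ 0 :=
        (Real.sqrt_pos.2 (by rcases lt_or_gt_of_ne h0 with h1 | h1 <;> [linarith; exact absurd h1 h])).ne'
      have := (((hasDerivAt_id θ).const_mul (Real.sqrt (-κ))).sinh).div_const (Real.sqrt (-κ))
      refine this.congr_deriv ?_
      simp only [id]
      field_simp

theorem sk_cont (κ : ℝ) : Continuous (sk κ) :=
  continuous_iff_continuousAt.2 fun θ => (sk_hasDerivAt κ θ).continuousAt

theorem ck_cont (κ : ℝ) : Continuous (ck κ) := by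
  unfold ck
  split_ifs <;> fun_prop

theorem sk_zero' (κ : ℝ) : sk κ 0 = 0 := by simp [sk]

theorem ck_zero' (κ : ℝ) : ck κ 0 = 1 := by simp [ck]

theorem norm_curve_deriv {E : Type*} [NormedAddCommGroup E] [InnerProductSpace ℝ E]
    (κ : ℝ) (ξ : ℝ → E) (v z : E) (t : ℝ) (h : HasDerivAt ξ v t) (hz : ξ t - z ≠ 0) :
    HasDerivAt (fun s => sk κ (‖ξ s - z‖ / 2) ^ 2)
      (sk κ (‖ξ t - z‖ / 2) * ck κ (‖ξ t - z‖ / 2) * (⟪ξ t - z, v⟫ / ‖ξ t - z‖)) t := by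
  have hp : 0 < ‖ξ t - z‖ := norm_pos_iff.2 hz
  have h1 : HasDerivAt (fun s => ‖ξ s - z‖ ^ 2) (2 * ⟪ξ t - z, v⟫) t :=
    (h.sub_const z).norm_sq
  have h2 := h1.sqrt (by positivity)
  have h3 : HasDerivAt (fun s => ‖ξ s - z‖) (⟪ξ t - z, v⟫ / ‖ξ t - z‖) t := by
    simp only [Real.sqrt_sq (norm_nonneg _)] at h2
    refine h2.congr_deriv ?_
    field_simp
  have h4 := ((sk_hasDerivAt κ (‖ξ t - z‖ / 2)).comp t (h3.div_const 2)).pow 2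
  refine h4.congr_deriv ?_
  simp only [Function.comp]
  field_simp
  push_cast
  ring

theorem stmt_2 {E : Type*} [NormedAddCommGroup E] [InnerProductSpace ℝ E]
    [FiniteDimensional ℝ E] [Nontrivial E]
    (f : E → ℝ) (hf : ContDiff ℝ 1 f) (K N : ℝ) (hN : N < 0)
    (T : ℝ) (ξ ξ' : ℝ → E)
    (hξc : ContinuousOn ξ (Set.Ico 0 T))
    (hξd : ∀ t ∈ Set.Ioo (0:ℝ) T, HasDerivAt ξ (ξ' t) t)
    (hξ'c : ContinuousOn ξ' (Set.Ioo 0 T))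
    (hEVI : ∀ z : E, ∀ᵐ t ∂(MeasureTheory.volume.restrict (Set.Ioo (0:ℝ) T)),
      (K < 0 → ‖ξ t - z‖ < π * Real.sqrt (N / K)) →
      ∀ D : ℝ, HasDerivAt (fun s => sk (K / N) (‖ξ s - z‖ / 2) ^ 2) D t →
        D + K * sk (K / N) (‖ξ t - z‖ / 2) ^ 2
          ≤ N / 2 * (1 - Real.exp (-f z / N) / Real.exp (-f (ξ t) / N))) :
    ∀ t ∈ Set.Ioo (0:ℝ) T, ξ' t = -(gradient f (ξ t)) := by
  intro t₀ ht₀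
  -- the pointwise inequality at `t₀` for nearby `z`
  have key : ∀ z : E, ξ t₀ - z ≠ 0 → (K < 0 → ‖ξ t₀ - z‖ < π * Real.sqrt (N / K)) →
      sk (K / N) (‖ξ t₀ - z‖ / 2) * ck (K / N) (‖ξ t₀ - z‖ / 2)
          * (⟪ξ t₀ - z, ξ' t₀⟫ / ‖ξ t₀ - z‖)
        + K * sk (K / N) (‖ξ t₀ - z‖ / 2) ^ 2
        - N / 2 * (1 - Real.exp (-f z / N) / Real.exp (-f (ξ t₀) / N)) ≤ 0 := by
    intro z hz hK
    have hae := hEVI z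
    rw [MeasureTheory.ae_restrict_iff' measurableSet_Ioo] at hae
    have hd := MeasureTheory.Measure.dense_of_ae hae
    have hfr := mem_closure_iff_frequently.1 (hd t₀)
    have hcξ : ContinuousAt ξ t₀ := (hξd t₀ ht₀).continuousAt
    have hcξ' : ContinuousAt ξ' t₀ := hξ'c.continuousAt (Ioo_mem_nhds ht₀.1 ht₀.2)
    have hcn : ContinuousAt (fun t => ‖ξ t - z‖) t₀ := (hcξ.sub continuousAt_const).norm
    have e1 : ∀ᶠ t in nhds t₀, t ∈ Set.Ioo 0 T := Ioo_mem_nhds ht₀.1 ht₀.2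
    have e2 : ∀ᶠ t in nhds t₀, ξ t - z ≠ 0 :=
      (hcξ.sub continuousAt_const).eventually_ne hz
    have e3 : ∀ᶠ t in nhds t₀, (K < 0 → ‖ξ t - z‖ < π * Real.sqrt (N / K)) := by
      by_cases h : K < 0
      · filter_upwards [hcn.eventually_lt continuousAt_const (hK h)] with t ht _ using ht
      · exact Filter.Eventually.of_forall fun t h' => absurd h' h
    have hcs : ContinuousAt (fun t => sk (K / N) (‖ξ t - z‖ / 2)) t₀ :=
      (sk_cont _).continuousAt.comp (hcn.div_const 2)
    have hcc : ContinuousAt (fun t => ck (K / N) (‖ξ t - z‖ / 2)) t₀ :=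
      (ck_cont _).continuousAt.comp (hcn.div_const 2)
    have hcf : ContinuousAt (fun t => f (ξ t)) t₀ := hf.continuous.continuousAt.comp hcξ
    have hci : ContinuousAt (fun t => (⟪ξ t - z, ξ' t⟫ : ℝ)) t₀ :=
      (hcξ.sub continuousAt_const).inner hcξ'
    have hce : ContinuousAt (fun t => Real.exp (-f (ξ t) / N)) t₀ :=
      (hcf.neg.div_const N).rexp
    have hcont : ContinuousAt (fun t =>
        sk (K / N) (‖ξ t - z‖ / 2) * ck (K / N) (‖ξ t - z‖ / 2)
          * (⟪ξ t - z, ξ' t⟫ / ‖ξ t - z‖)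
        + K * sk (K / N) (‖ξ t - z‖ / 2) ^ 2
        - N / 2 * (1 - Real.exp (-f z / N) / Real.exp (-f (ξ t) / N))) t₀ :=
      (((hcs.mul hcc).mul (hci.div hcn (norm_ne_zero_iff.2 hz))).add
        (continuousAt_const.mul (hcs.pow 2))).sub
        (continuousAt_const.mul (continuousAt_const.sub
          (continuousAt_const.div hce (Real.exp_pos _).ne')))
    have hfr2 := hfr.and_eventually (e1.and (e2.and e3))
    have := mem_closure_of_frequently_of_tendsto (s := Set.Iic (0:ℝ))
      (hfr2.mono fun t ht => ?_) hcont
    · rwa [isClosed_Iic.closure_eq] at this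
    · obtain ⟨hP, h1, h2, h3⟩ := ht
      have := hP h1 h3 _ (norm_curve_deriv (K / N) ξ (ξ' t) z t (hξd t h1) h2)
      simp only [Set.mem_Iic]
      linarith
  -- differentiate in direction `v`
  have hdir : ∀ v : E, ‖v‖ = 1 → 0 ≤ ⟪gradient f (ξ t₀), v⟫ + ⟪v, ξ' t₀⟫ := by
    intro v hv
    have hfd : HasGradientAt f (gradient f (ξ t₀)) (ξ t₀) :=
      (hf.differentiable one_ne_zero (ξ t₀)).hasGradientAt
    have hline : HasDerivAt (fun ε : ℝ => ξ t₀ + ε • v) v 0 := by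
      simpa using ((hasDerivAt_id (0:ℝ)).smul_const v).const_add (ξ t₀)
    have hfl : HasDerivAt (fun ε : ℝ => f (ξ t₀ + ε • v)) ⟪gradient f (ξ t₀), v⟫ 0 := by
      have h := hfd.hasFDerivAt
      have h' : HasFDerivAt f (InnerProductSpace.toDual ℝ E (gradient f (ξ t₀)))
          ((fun ε : ℝ => ξ t₀ + ε • v) 0) := by simpa using h
      exact h'.comp_hasDerivAt (0:ℝ) hline
    have hs : HasDerivAt (fun ε : ℝ => sk (K / N) (ε / 2)) (1 / 2) 0 := by
      have := (sk_hasDerivAt (K / N) ((0:ℝ) / 2)).comp (0:ℝ) ((hasDerivAt_id (0:ℝ)).div_const 2)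
      simpa [ck_zero', Function.comp_def] using this
    -- no differentiability of `ck` needed: use the slope limit
    have hR : HasDerivAt (fun ε : ℝ => N / 2 * (1 - Real.exp (-f (ξ t₀ + ε • v) / N)
        / Real.exp (-f (ξ t₀) / N))) (⟪gradient f (ξ t₀), v⟫ / 2) 0 := by
      have := ((((hfl.neg.div_const N).exp).div_const
        (Real.exp (-f (ξ t₀) / N))).const_sub 1).const_mul (N / 2)
      refine this.congr_deriv ?_
      have hN' := hN.ne
      have he := (Real.exp_pos (-f (ξ t₀) / N)).ne'
      simp only [Pi.neg_apply, zero_smul, add_zero]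
      field_simp
    have hRs := hR.tendsto_slope_zero_right
    have hss := hs.tendsto_slope_zero_right
    have hc0 : Filter.Tendsto (fun ε : ℝ => ck (K / N) (ε / 2)) (nhdsWithin 0 (Set.Ioi 0))
        (nhds 1) := by
      have : Continuous (fun ε : ℝ => ck (K / N) (ε / 2)) := (ck_cont _).comp (by fun_prop)
      have := this.tendsto 0
      simp only [zero_div, ck_zero'] at this
      exact this.mono_left nhdsWithin_le_nhds
    have hs0 : Filter.Tendsto (fun ε : ℝ => sk (K / N) (ε / 2)) (nhdsWithin 0 (Set.Ioi 0))
        (nhds 0) := by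
      have : Continuous (fun ε : ℝ => sk (K / N) (ε / 2)) := (sk_cont _).comp (by fun_prop)
      have := this.tendsto 0
      simp only [zero_div, sk_zero'] at this
      exact this.mono_left nhdsWithin_le_nhds
    have hlim := (hRs.add ((hss.mul hc0).mul_const ⟪v, ξ' t₀⟫)).sub ((hss.mul hs0).const_mul K)
    have hlim' := ge_of_tendsto (b := (0:ℝ)) hlim ?_
    · linarith
    · have hsmall : ∀ᶠ ε : ℝ in nhdsWithin 0 (Set.Ioi 0),
          (K < 0 → ε < π * Real.sqrt (N / K)) := by
        by_cases h : K < 0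
        · have hpos : 0 < π * Real.sqrt (N / K) :=
            mul_pos Real.pi_pos (Real.sqrt_pos.2 (div_pos_of_neg_of_neg hN h))
          filter_upwards [nhdsWithin_le_nhds (Iio_mem_nhds hpos)] with ε hε _ using hε
        · exact Filter.Eventually.of_forall fun t h' => absurd h' h
      filter_upwards [hsmall, self_mem_nhdsWithin] with ε hε hε0
      have hε0 : 0 < ε := hε0
      have hsub : ξ t₀ - (ξ t₀ + ε • v) = -(ε • v) := by abel
      have hnorm : ‖ξ t₀ - (ξ t₀ + ε • v)‖ = ε := by
        rw [hsub, norm_neg, norm_smul, hv, mul_one, Real.norm_of_nonneg hε0.le]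
      have hk := key (ξ t₀ + ε • v) (norm_ne_zero_iff.1 (by rw [hnorm]; exact hε0.ne'))
        (by rw [hnorm]; exact hε)
      rw [hnorm, hsub, inner_neg_left, real_inner_smul_left] at hk
      have hq : -(ε * ⟪v, ξ' t₀⟫) / ε = -⟪v, ξ' t₀⟫ := by field_simp
      rw [hq] at hk
      have he := (Real.exp_pos (-f (ξ t₀) / N)).ne'
      simp only [zero_add, zero_div, sk_zero', sub_zero, zero_smul, add_zero, div_self he,
        sub_self, mul_zero, smul_eq_mul]
      have h0 := mul_nonneg (inv_pos.2 hε0).le (neg_nonneg.2 hk)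
      refine h0.trans_eq ?_
      ring
  by_contra hne
  have hw : ξ' t₀ + gradient f (ξ t₀) ≠ 0 := fun h => hne (eq_neg_of_add_eq_zero_left h)
  set w := ξ' t₀ + gradient f (ξ t₀) with hwdef
  have hwp : 0 < ‖w‖ := norm_pos_iff.2 hw
  have h1 := hdir (-(‖w‖⁻¹ • w)) (by
    rw [norm_neg, norm_smul, norm_inv, norm_norm, inv_mul_cancel₀ hwp.ne'])
  rw [real_inner_comm, ← inner_add_right, add_comm, ← hwdef, inner_neg_left,
    real_inner_smul_left, real_inner_self_eq_norm_sq] at h1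
  have : 0 < ‖w‖⁻¹ * ‖w‖ ^ 2 := by positivity
  linarith
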